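/- Fix τ ∈ (0,1). Let Y be an integrable real-valued random variable with cumulative distribution function F, and let q ∈ ℝ with F(q) = τ. Suppose there exist constants c₀ > 0 and c₁ > 0 such that |F(q + u) − F(q)| ≥ c₁ u² for all u with |u| ≤ c₀ (Assumption A1 centered at q). Then, using monotonicity of F, for every u with |u| ≤ c₀ one has E[ρ_τ(Y − (q + u))] − E[ρ_τ(Y − q)] ≥ (c₁/3) |u|³. -/

import Mathlib

open MeasureTheory

/-- The check (pinball) loss function of quantile regression:
`ρ_τ(r) = τ r` if `r > 0` and `−(1−τ) r` if `r ≤ 0`. -/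
noncomputable def checkFn (τ r : ℝ) : ℝ := if 0 < r then τ * r else -(1 - τ) * r

lemma checkFn_eq_add_max (τ r : ℝ) : checkFn τ r = τ * r + max (-r) 0 := by
  unfold checkFn
  split_ifs with h
  · rw [max_eq_right (by linarith)]; ring
  · rw [max_eq_left (by linarith)]; ring

lemma continuous_checkFn (τ : ℝ) : Continuous (checkFn τ) := by
  simp only [funext (checkFn_eq_add_max τ)]
  fun_prop

lemma abs_checkFn_le {τ : ℝ} (hτ : τ ∈ Set.Icc (0 : ℝ) 1) (r : ℝ) : |checkFn τ r| ≤ |r| := by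
  obtain ⟨h0, h1⟩ := hτ
  unfold checkFn
  split_ifs
  · rw [abs_mul, abs_of_nonneg h0]
    exact mul_le_of_le_one_left (abs_nonneg r) h1
  · rw [abs_mul, abs_neg, abs_of_nonneg (by linarith)]
    exact mul_le_of_le_one_left (abs_nonneg r) (by linarith)

/-- Knight's identity. -/
lemma integral_ite_le_sub_eq_checkFn_sub (τ y a b : ℝ) :
    ∫ s in a..b, ((if y ≤ s then (1 : ℝ) else 0) - τ) = checkFn τ (y - b) - checkFn τ (y - a) := by
  refine integral_eq_of_hasDerivAt_off_countable (fun s => checkFn τ (y - s)) _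
    (Set.countable_singleton y) ((continuous_checkFn τ).comp (by fun_prop)).continuousOn ?_ ?_
  · rintro s ⟨-, hs⟩
    rcases lt_or_gt_of_ne (show s ≠ y from hs) with h | h
    · have hd : HasDerivAt (fun s => τ * (y - s)) (τ * (-1)) s :=
        ((hasDerivAt_id s).const_sub y).const_mul τ
      rw [if_neg (not_le.mpr h), show (0 : ℝ) - τ = τ * (-1) by ring]
      refine hd.congr_of_eventuallyEq ?_
      filter_upwards [Iio_mem_nhds h] with t ht
      exact if_pos (sub_pos.mpr ht)
    · have hd : HasDerivAt (fun s => -(1 - τ) * (y - s)) (-(1 - τ) * (-1)) s :=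
        ((hasDerivAt_id s).const_sub y).const_mul _
      rw [if_pos h.le, show (1 : ℝ) - τ = -(1 - τ) * (-1) by ring]
      refine hd.congr_of_eventuallyEq ?_
      filter_upwards [Ioi_mem_nhds h] with t ht
      exact if_neg (not_lt.mpr (sub_nonpos.mpr (le_of_lt ht)))
  · refine Monotone.intervalIntegrable fun s t hst => sub_le_sub_right ?_ τ
    split_ifs with h1 h2
    · exact le_rfl
    · exact absurd (h1.trans hst) h2
    · exact zero_le_one
    · exact le_rfl

lemma integrable_checkFn_sub {μ : Measure ℝ} [IsFiniteMeasure μ]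
    (hμ : Integrable (fun y => y) μ) {τ : ℝ} (hτ : τ ∈ Set.Icc (0 : ℝ) 1) (a : ℝ) :
    Integrable (fun y => checkFn τ (y - a)) μ :=
  (hμ.sub (integrable_const a)).mono
    ((continuous_checkFn τ).comp (by fun_prop)).aestronglyMeasurable
    (Filter.Eventually.of_forall fun _ => abs_checkFn_le hτ _)

lemma integral_checkFn_sub_integral_checkFn {μ : Measure ℝ} [IsProbabilityMeasure μ]
    (hμ : Integrable (fun y => y) μ) {τ : ℝ} (hτ : τ ∈ Set.Icc (0 : ℝ) 1) (a b : ℝ) :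
    ∫ y, checkFn τ (y - b) ∂μ - ∫ y, checkFn τ (y - a) ∂μ =
      ∫ s in a..b, (μ.real (Set.Iic s) - τ) := by
  rw [← integral_sub (integrable_checkFn_sub hμ hτ b) (integrable_checkFn_sub hμ hτ a)]
  simp_rw [← integral_ite_le_sub_eq_checkFn_sub]
  rw [← intervalIntegral_integral_swap]
  · refine intervalIntegral.integral_congr fun s _ => ?_
    have hind : (fun y : ℝ => if y ≤ s then (1 : ℝ) else 0) = (Set.Iic s).indicator 1 := by
      ext y
      simp [Set.indicator_apply]
    have hint : Integrable (fun y : ℝ => if y ≤ s then (1 : ℝ) else 0) μ := by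
      rw [hind]
      exact (integrable_const (1 : ℝ)).indicator measurableSet_Iic
    rw [integral_sub hint (integrable_const τ), hind, integral_indicator_one measurableSet_Iic]
    simp
  · have hm : Measurable (fun p : ℝ × ℝ => (if p.2 ≤ p.1 then (1 : ℝ) else 0) - τ) :=
      (Measurable.ite (measurableSet_le measurable_snd measurable_fst) measurable_const
        measurable_const).sub_const τ
    have : IsFiniteMeasure (volume.restrict (Set.uIoc a b)) :=
      ⟨by simp [Set.uIoc]⟩
    refine Integrable.of_bound (C := 1) hm.aestronglyMeasurable
      (Filter.Eventually.of_forall fun p => ?_)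
    simp only [Function.uncurry, Real.norm_eq_abs]
    obtain ⟨h0, h1⟩ := hτ
    split_ifs <;> rw [abs_le] <;> constructor <;> linarith

/-- A monotone function growing at least quadratically away from `q` has cubically growing
primitive. -/
lemma Monotone.cube_le_integral_sub {F : ℝ → ℝ} (hF : Monotone F) {q c₀ c₁ : ℝ}
    (hgrowth : ∀ u : ℝ, |u| ≤ c₀ → c₁ * u ^ 2 ≤ |F (q + u) - F q|) {u : ℝ} (hu : |u| ≤ c₀) :
    c₁ / 3 * |u| ^ 3 ≤ ∫ s in q..q + u, (F s - F q) := by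
  have hprim (a b : ℝ) : ∫ s in a..b, c₁ * (s - q) ^ 2 =
      c₁ / 3 * ((b - q) ^ 3 - (a - q) ^ 3) := by
    rw [intervalIntegral.integral_const_mul,
      intervalIntegral.integral_comp_sub_right (fun s => s ^ 2), integral_pow]
    norm_num
    ring
  have hquad (a b : ℝ) : IntervalIntegrable (fun s => c₁ * (s - q) ^ 2) volume a b :=
    Continuous.intervalIntegrable (by fun_prop) a b
  have hsub (a b : ℝ) : IntervalIntegrable (fun s => F s - F q) volume a b :=
    hF.intervalIntegrable.sub intervalIntegrable_const
  rcases le_total 0 u with h | h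
  · rw [abs_of_nonneg h] at hu ⊢
    calc c₁ / 3 * u ^ 3 = ∫ s in q..q + u, c₁ * (s - q) ^ 2 := by rw [hprim]; ring
      _ ≤ _ := by
        refine intervalIntegral.integral_mono_on (by linarith) (hquad _ _) (hsub _ _) ?_
        rintro s ⟨hs1, hs2⟩
        have := hgrowth (s - q) (by rw [abs_of_nonneg] <;> linarith)
        rwa [add_sub_cancel, abs_of_nonneg (sub_nonneg.mpr (hF hs1))] at this
  · rw [abs_of_nonpos h] at hu ⊢
    rw [intervalIntegral.integral_symm, ← intervalIntegral.integral_neg]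
    calc c₁ / 3 * (-u) ^ 3 = ∫ s in q + u..q, c₁ * (s - q) ^ 2 := by rw [hprim]; ring
      _ ≤ _ := by
        refine intervalIntegral.integral_mono_on (by linarith) (hquad _ _) (hsub _ _).neg ?_
        rintro s ⟨hs1, hs2⟩
        have := hgrowth (s - q) (by rw [abs_of_nonpos] <;> linarith)
        rwa [add_sub_cancel, abs_of_nonpos (sub_nonpos.mpr (hF hs2))] at this

/-- For `τ ∈ (0,1)`, an integrable real random variable `Y` with CDF `F`,
and `q` with `F(q) = τ`, if `|F(q+u) − F(q)| ≥ c₁ u²` for all `|u| ≤ c₀`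
(Assumption A1 centered at `q`, with `c₀, c₁ > 0`), then for every `|u| ≤ c₀`,
`E[ρ_τ(Y − (q+u))] − E[ρ_τ(Y − q)] ≥ (c₁/3)|u|³`. -/
theorem expected_check_loss_local_growth {Ω : Type*} [MeasureSpace Ω]
    [IsProbabilityMeasure (volume : Measure Ω)]
    (τ : ℝ) (hτ : τ ∈ Set.Ioo (0:ℝ) 1)
    (Y : Ω → ℝ) (hY : Integrable Y)
    (q : ℝ) (hq : (volume {ω | Y ω ≤ q}).toReal = τ)
    (c₀ c₁ : ℝ) (hc₀ : 0 < c₀) (hc₁ : 0 < c₁)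
    (hA1 : ∀ u : ℝ, |u| ≤ c₀ →
      c₁ * u ^ 2 ≤ |(volume {ω | Y ω ≤ q + u}).toReal - (volume {ω | Y ω ≤ q}).toReal|) :
    ∀ u : ℝ, |u| ≤ c₀ →
      c₁ / 3 * |u| ^ 3 ≤
        (∫ ω, checkFn τ (Y ω - (q + u))) - ∫ ω, checkFn τ (Y ω - q) := by
  intro u hu
  have hYm : AEMeasurable Y := hY.aemeasurable
  set μ : Measure ℝ := volume.map Y with hμ_def
  have : IsProbabilityMeasure μ := Measure.isProbabilityMeasure_map hYm
  have hμ : Integrable (fun y => y) μ :=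
    (integrable_map_measure aestronglyMeasurable_id hYm).mpr hY
  have hcdf (t : ℝ) : (volume {ω | Y ω ≤ t}).toReal = μ.real (Set.Iic t) := by
    rw [measureReal_def, hμ_def, Measure.map_apply_of_aemeasurable hYm measurableSet_Iic]
    rfl
  have hmap (a : ℝ) : ∫ ω, checkFn τ (Y ω - a) = ∫ y, checkFn τ (y - a) ∂μ :=
    (integral_map (f := fun y => checkFn τ (y - a)) hYm
      ((continuous_checkFn τ).comp (continuous_sub_right a)).aestronglyMeasurable).symm
  simp only [hcdf] at hq hA1
  rw [hmap, hmap, integral_checkFn_sub_integral_checkFn hμ (Set.Ioo_subset_Icc_self hτ), ← hq]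
  have hF : Monotone fun t => μ.real (Set.Iic t) :=
    fun _ _ h => measureReal_mono (Set.Iic_subset_Iic.mpr h)
  exact hF.cube_le_integral_sub hA1 hu
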